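/- Let 𝔄 be a structure over the vocabulary {V, H, C, U, P, Q} such that the extension of U has exactly two elements, and such that for all a, b ∈ A: H(a,b) implies (C(a) ⇔ C(b)) and V(a,b) implies (C(a) ⇔ ¬C(b)). Let φ_non-C⁺-join be the dependence-logic sentence ∀x(¬U(x) ∨ ∃y(C(y) ∧ =(y,x) ∧ ∃x(=(x,y) ∧ ((=(x) ∧ H(x,y)) ∨ (=(x) ∧ V(x,y))) ∧ ∃y(=(y) ∧ (V(y,x) ∨ H(y,x)) ∧ ¬C(y))))), let φ_non-C⁻-join be obtained from it by replacing each occurrence of C(x) and C(y) by ¬C(x) and ¬C(y), and let φ_non-join := φ_non-C⁺-join ∨ φ_non-C⁻-join. Then 𝔄 ⊨ φ_non-join if and only if there exist a, b, b', c, c' ∈ A with V(a,b), H(b,c), H(a,b'), V(b',c') and c ≠ c' (i.e., condition (3) of gridlikeness fails in 𝔄). -/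

import Mathlib

/-- A relational signature: a type of relation symbols with arities. -/
structure Signature : Type 1 where
  Rel : Type
  arity : Rel → ℕ

/-- A relational structure over a signature. -/
structure Struc (σ : Signature) : Type 1 where
  A : Type
  interp : (r : σ.Rel) → (Fin (σ.arity r) → A) → Prop

/-- A generalized atom of type `(ty 0, ..., ty (t-1))`, given by a generalized
quantifier `Q`: a class of structures `(A, B_1, ..., B_t)` with `B_j ⊆ A^{ty j}`. -/
structure GenAtom : Type 1 where
  t : ℕ
  ty : Fin t → ℕ
  Q : (A : Type) → ((j : Fin t) → Set (Fin (ty j) → A)) → Prop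

/-- Formulas of `FO(𝒜)` in negation normal form. Variables are natural numbers;
`ga : ι → GenAtom` is the collection 𝒜 of generalized atoms. -/
inductive Fml (σ : Signature) {ι : Type} (ga : ι → GenAtom) : Type where
  | rel (r : σ.Rel) (v : Fin (σ.arity r) → ℕ)
  | nrel (r : σ.Rel) (v : Fin (σ.arity r) → ℕ)
  | eq (m n : ℕ)
  | neq (m n : ℕ)
  | and (φ ψ : Fml σ ga)
  | or (φ ψ : Fml σ ga)
  | ex (x : ℕ) (φ : Fml σ ga)
  | all (x : ℕ) (φ : Fml σ ga)
  | atom (i : ι) (v : (j : Fin (ga i).t) → Fin ((ga i).ty j) → ℕ)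

/-- The updated assignment `s[a/x]`. -/
def upd {A : Type} (s : ℕ → A) (x : ℕ) (a : A) : ℕ → A :=
  fun n => if n = x then a else s n

/-- `rel(X, ȳ)`: the relation that a team `X` induces via a tuple `v` of variables. -/
def relOf {A : Type} (X : Set (ℕ → A)) {m : ℕ} (v : Fin m → ℕ) : Set (Fin m → A) :=
  (fun s => fun k => s (v k)) '' X

variable {σ : Signature} {ι : Type} {ga : ι → GenAtom}

/-- Lax team semantics for `FO(𝒜)`. A team is a set of assignments `ℕ → M.A`. -/
def TSat (M : Struc σ) : Fml σ ga → Set (ℕ → M.A) → Prop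
  | .rel r v, X => ∀ s ∈ X, M.interp r (fun k => s (v k))
  | .nrel r v, X => ∀ s ∈ X, ¬ M.interp r (fun k => s (v k))
  | .eq m n, X => ∀ s ∈ X, s m = s n
  | .neq m n, X => ∀ s ∈ X, s m ≠ s n
  | .and φ ψ, X => TSat M φ X ∧ TSat M ψ X
  | .or φ ψ, X => ∃ Y Z, X = Y ∪ Z ∧ TSat M φ Y ∧ TSat M ψ Z
  | .ex x φ, X => ∃ F : (ℕ → M.A) → Set M.A, (∀ s ∈ X, (F s).Nonempty) ∧
      TSat M φ {s' | ∃ s ∈ X, ∃ a ∈ F s, s' = upd s x a}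
  | .all x φ, X => TSat M φ {s' | ∃ s ∈ X, ∃ a : M.A, s' = upd s x a}
  | .atom i v, X => (ga i).Q M.A (fun j => relOf X (v j))

/-- The set of free variables of a formula. -/
def Fr : Fml σ ga → Set ℕ
  | .rel _ v => Set.range v
  | .nrel _ v => Set.range v
  | .eq m n => {m, n}
  | .neq m n => {m, n}
  | .and φ ψ => Fr φ ∪ Fr ψ
  | .or φ ψ => Fr φ ∪ Fr ψ
  | .ex x φ => Fr φ \ {x}
  | .all x φ => Fr φ \ {x}
  | .atom _ v => ⋃ j, Set.range (v j)

/-- The set of all variables occurring in a formula (free or bound). -/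
def Vars : Fml σ ga → Set ℕ
  | .rel _ v => Set.range v
  | .nrel _ v => Set.range v
  | .eq m n => {m, n}
  | .neq m n => {m, n}
  | .and φ ψ => Vars φ ∪ Vars ψ
  | .or φ ψ => Vars φ ∪ Vars ψ
  | .ex x φ => insert x (Vars φ)
  | .all x φ => insert x (Vars φ)
  | .atom _ v => ⋃ j, Set.range (v j)

/-- Truth of a sentence `φ` in a structure `M`: satisfaction by the team of all
assignments, which (for sentences, by locality) represents satisfaction by the
team `{∅}` containing only the empty assignment. -/
def TTrue (M : Struc σ) (φ : Fml σ ga) : Prop :=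
  TSat M φ (Set.univ : Set (ℕ → M.A))

/-- The relation symbols of the vocabulary `{V, H, C, U, P, Q}`:
`V`, `H` binary, `C`, `U`, `P`, `Q` unary. -/
inductive GRel : Type where
  | V | H | C | U | P | Q
deriving DecidableEq

/-- The vocabulary `{V, H, C, U, P, Q}`. -/
def gridSig : Signature :=
  ⟨GRel, fun r => match r with
    | .V => 2 | .H => 2 | .C => 1 | .U => 1 | .P => 1 | .Q => 1⟩

/-- The `{V,H,C,U,P,Q}`-structure with domain `A` determined by the given
relations and sets. -/
def mkGrid (A : Type) (Vr Hr : A → A → Prop) (Cs Us Ps Qs : Set A) :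
    Struc gridSig :=
  ⟨A, fun r => match r with
    | .V => fun w => Vr (w (0 : Fin 2)) (w (1 : Fin 2))
    | .H => fun w => Hr (w (0 : Fin 2)) (w (1 : Fin 2))
    | .C => fun w => w (0 : Fin 1) ∈ Cs
    | .U => fun w => w (0 : Fin 1) ∈ Us
    | .P => fun w => w (0 : Fin 1) ∈ Ps
    | .Q => fun w => w (0 : Fin 1) ∈ Qs⟩

section Literals
variable {ι : Type} {ga : ι → GenAtom}

/-- Literal `V(a,b)`. -/
def lV (a b : ℕ) : Fml gridSig ga := Fml.rel GRel.V ![a, b]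
/-- Literal `H(a,b)`. -/
def lH (a b : ℕ) : Fml gridSig ga := Fml.rel GRel.H ![a, b]
/-- Literal `¬V(a,b)`. -/
def lnV (a b : ℕ) : Fml gridSig ga := Fml.nrel GRel.V ![a, b]
/-- Literal `¬H(a,b)`. -/
def lnH (a b : ℕ) : Fml gridSig ga := Fml.nrel GRel.H ![a, b]
/-- Literal `C(a)`. -/
def lC (a : ℕ) : Fml gridSig ga := Fml.rel GRel.C ![a]
/-- Literal `¬C(a)`. -/
def lnC (a : ℕ) : Fml gridSig ga := Fml.nrel GRel.C ![a]
/-- Literal `U(a)`. -/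
def lU (a : ℕ) : Fml gridSig ga := Fml.rel GRel.U ![a]
/-- Literal `¬U(a)`. -/
def lnU (a : ℕ) : Fml gridSig ga := Fml.nrel GRel.U ![a]
/-- Literal `P(a)`. -/
def lP (a : ℕ) : Fml gridSig ga := Fml.rel GRel.P ![a]
/-- Literal `¬P(a)`. -/
def lnP (a : ℕ) : Fml gridSig ga := Fml.nrel GRel.P ![a]
/-- Literal `Q(a)`. -/
def lQ (a : ℕ) : Fml gridSig ga := Fml.rel GRel.Q ![a]
/-- Literal `¬Q(a)`. -/
def lnQ (a : ℕ) : Fml gridSig ga := Fml.nrel GRel.Q ![a]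

/-- `φ_non-singleton(X) := ∀x ¬X(x) ∨ ∃x∃y(X(x) ∧ X(y) ∧ x ≠ y)`, where the
literals `X(·)`/`¬X(·)` are supplied as `lit`/`nlit`.  (`x` is variable `0`,
`y` is variable `1`.) -/
def nonSingletonF (lit nlit : ℕ → Fml gridSig ga) : Fml gridSig ga :=
  .or (.all 0 (nlit 0))
      (.ex 0 (.ex 1 (.and (lit 0) (.and (lit 1) (.neq 0 1)))))

/-- `φ_non-distinct(X,Y) := ∃x(X(x) ∧ Y(x))`. -/
def nonDistinctF (litX litY : ℕ → Fml gridSig ga) : Fml gridSig ga :=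
  .ex 0 (.and (litX 0) (litY 0))

/-- `φ_non-union(X,Y,Z) := ∃x(X(x) ∧ (¬Y(x) ∨ ¬Z(x))) ∨ ∃x(¬X(x) ∧ (Y(x) ∨ Z(x)))`. -/
def nonUnionF (litX nlitX litY nlitY litZ nlitZ : ℕ → Fml gridSig ga) :
    Fml gridSig ga :=
  .or (.ex 0 (.and (litX 0) (.or (nlitY 0) (nlitZ 0))))
      (.ex 0 (.and (nlitX 0) (.or (litY 0) (litZ 0))))

/-- `φ_{|U|≠2} := φ_non-singleton(P) ∨ φ_non-singleton(Q) ∨ φ_non-distinct(P,Q)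
∨ φ_non-union(U,P,Q)`. -/
def phiUne2 : Fml gridSig ga :=
  .or (nonSingletonF lP lnP)
      (.or (nonSingletonF lQ lnQ)
           (.or (nonDistinctF lP lQ)
                (nonUnionF lU lnU lP lnP lQ lnQ)))

end Literals

/-- The dependence atom `=(x_1,...,x_n,y)` as a generalized atom of type
`(n+1)`: all tuples in the induced relation agreeing on the first `n`
coordinates agree on the last one. -/
def depAtom (n : ℕ) : GenAtom where
  t := 1
  ty := fun _ => n + 1
  Q := fun A R => ∀ w ∈ R 0, ∀ w' ∈ R 0,
    (∀ i : Fin n, w i.castSucc = w' i.castSucc) → w (Fin.last n) = w' (Fin.last n)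

/-- The constancy atom `=(a)`. -/
def dConst (a : ℕ) : Fml gridSig depAtom := Fml.atom 0 (fun _ => ![a])

/-- The dependence atom `=(a, b)` ("`b` depends only on `a`"). -/
def dDep (a b : ℕ) : Fml gridSig depAtom := Fml.atom 1 (fun _ => ![a, b])

/-- `∀x(¬U(x) ∨ ∃y(C⁺(y) ∧ =(y,x) ∧ ∃x(=(x,y) ∧ ((=(x) ∧ H(x,y)) ∨ (=(x) ∧ V(x,y)))
∧ ∃y(=(y) ∧ (V(y,x) ∨ H(y,x)) ∧ C⁻(y)))))`, where the positive/negative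
`C`-literals `C⁺`/`C⁻` are supplied as arguments (`x` is `0`, `y` is `1`). -/
def nonCjoinF (cpos cneg : ℕ → Fml gridSig depAtom) : Fml gridSig depAtom :=
  .all 0 (.or (lnU 0)
    (.ex 1 (.and (cpos 1) (.and (dDep 1 0)
      (.ex 0 (.and (dDep 0 1)
        (.and (.or (.and (dConst 0) (lH 0 1)) (.and (dConst 0) (lV 0 1)))
          (.ex 1 (.and (dConst 1)
            (.and (.or (lV 1 0) (lH 1 0)) (cneg 1)))))))))))

/-- `φ_non-C⁺-join`. -/
def phiNonCPlusJoin : Fml gridSig depAtom := nonCjoinF lC lnC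

/-- `φ_non-C⁻-join`: obtained from `φ_non-C⁺-join` by replacing the positive
`C`-literals by negative ones and vice versa. -/
def phiNonCMinusJoin : Fml gridSig depAtom := nonCjoinF lnC lC

/-- `φ_non-join := φ_non-C⁺-join ∨ φ_non-C⁻-join`. -/
def phiNonJoin : Fml gridSig depAtom := .or phiNonCPlusJoin phiNonCMinusJoin

/-- The update `s[a/x]` takes the value `a` at `x`. -/
theorem upd_same {A : Type} (s : ℕ → A) (x : ℕ) (a : A) : upd s x a x = a := by
  simp [upd]

/-- The empty team property of dependence logic. -/
theorem tsat_empty {τ : Signature} (M : Struc τ) (φ : Fml τ depAtom) : TSat M φ ∅ := by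
  induction φ with
  | rel | nrel | eq | neq => simp [TSat]
  | and φ ψ hφ hψ => exact ⟨hφ, hψ⟩
  | or φ ψ hφ hψ => exact ⟨∅, ∅, by simp, hφ, hψ⟩
  | ex x φ hφ => exact ⟨fun _ => ∅, by simp, by simpa using hφ⟩
  | all x φ hφ => simpa [TSat] using hφ
  | atom i v => simp [TSat, depAtom, relOf]

theorem tsat_dConst (M : Struc gridSig) (a : ℕ) (X : Set (ℕ → M.A)) :
    TSat M (dConst a) X ↔ ∀ s ∈ X, ∀ s' ∈ X, s a = s' a := by
  simp [TSat, dConst, depAtom, relOf]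

theorem tsat_dDep (M : Struc gridSig) (a b : ℕ) (X : Set (ℕ → M.A)) :
    TSat M (dDep a b) X ↔ ∀ s ∈ X, ∀ s' ∈ X, s a = s' a → s b = s' b := by
  simp [TSat, dDep, depAtom, relOf, Fin.last]

/-- On a nonempty team, `nonCjoinF` says that `V` followed by `H` and `H` followed by `V`
lead from some point outside `D` to distinct points, where `D` is the set defined by the
positive literal. -/
theorem tsat_nonCjoinF {A : Type} {Vr Hr : A → A → Prop} {Cs Us Ps Qs : Set A}
    (hU : ∃ u v : A, u ≠ v ∧ Us = {u, v}) (D : Set A)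
    (hH : ∀ a b : A, Hr a b → (a ∈ D ↔ b ∈ D))
    (hV : ∀ a b : A, Vr a b → (a ∈ D ↔ b ∉ D))
    (cpos cneg : ℕ → Fml gridSig depAtom)
    (hpos : ∀ n (X : Set (ℕ → A)),
      TSat (mkGrid A Vr Hr Cs Us Ps Qs) (cpos n) X ↔ ∀ s ∈ X, s n ∈ D)
    (hneg : ∀ n (X : Set (ℕ → A)),
      TSat (mkGrid A Vr Hr Cs Us Ps Qs) (cneg n) X ↔ ∀ s ∈ X, s n ∉ D)
    {X : Set (ℕ → A)} (hX : X.Nonempty) :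
    TSat (mkGrid A Vr Hr Cs Us Ps Qs) (nonCjoinF cpos cneg) X ↔
      ∃ a b c b' c' : A, a ∉ D ∧ Vr a b ∧ Hr b c ∧ Hr a b' ∧ Vr b' c' ∧ c ≠ c' := by
  obtain ⟨u, v, huv, rfl⟩ := hU
  constructor
  · rintro ⟨(Y : Set (ℕ → A)), (Z : Set (ℕ → A)), hYZ, hY, (F : (ℕ → A) → Set A), hF, hC, hdep,
      (G : (ℕ → A) → Set A), hG, hdep',
      ⟨(T₁ : Set (ℕ → A)), (T₂ : Set (ℕ → A)), hT, ⟨hc₁, hH₁⟩, hc₂, hV₂⟩,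
      (K : (ℕ → A) → Set A), hK, hcK,
      ⟨(R₁ : Set (ℕ → A)), (R₂ : Set (ℕ → A)), hR, hR₁, hR₂⟩, hnC⟩
    replace hC := (hpos _ _).1 hC
    replace hnC := (hneg _ _).1 hnC
    replace hdep := (tsat_dDep _ _ _ _).1 hdep
    replace hdep' := (tsat_dDep _ _ _ _).1 hdep'
    replace hc₁ := (tsat_dConst _ _ _).1 hc₁
    replace hc₂ := (tsat_dConst _ _ _).1 hc₂
    replace hcK := (tsat_dConst _ _ _).1 hcK
    dsimp only [mkGrid] at hYZ hF hC hdep hG hdep' hT hc₁ hc₂ hK hcK hR hnC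
    change ∀ s ∈ Y, ¬ s 0 ∈ ({u, v} : Set A) at hY
    change ∀ s ∈ T₁, Hr (s 0) (s 1) at hH₁
    change ∀ s ∈ T₂, Vr (s 0) (s 1) at hV₂
    change ∀ s ∈ R₁, Vr (s 1) (s 0) at hR₁
    change ∀ s ∈ R₂, Hr (s 1) (s 0) at hR₂
    obtain ⟨s, hs⟩ := hX
    have key : ∀ w ∈ ({u, v} : Set A), ∃ y x : A, y ∈ D ∧
        upd (upd s 0 w) 1 y ∈ {s' | ∃ s ∈ Z, ∃ a ∈ F s, s' = upd s 1 a} ∧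
        upd (upd (upd s 0 w) 1 y) 0 x ∈ T₁ ∪ T₂ := by
      intro w hw
      have hmem : upd s 0 w ∈ Y ∪ Z := hYZ ▸ ⟨s, hs, w, rfl⟩
      have hZ : upd s 0 w ∈ Z := hmem.resolve_left fun h => hY _ h (by rwa [upd_same])
      obtain ⟨y, hy⟩ := hF _ hZ
      have hy' : upd (upd s 0 w) 1 y ∈ {s' | ∃ s ∈ Z, ∃ a ∈ F s, s' = upd s 1 a} :=
        ⟨_, hZ, y, hy, rfl⟩
      obtain ⟨x, hx⟩ := hG _ hy'
      refine ⟨y, x, ?_, hy', hT ▸ ⟨_, hy', x, hx, rfl⟩⟩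
      simpa [upd_same] using hC _ hy'
    obtain ⟨y₁, x₁, hyD₁, hm₁, ht₁⟩ := key u (by simp)
    obtain ⟨y₂, x₂, hyD₂, hm₂, ht₂⟩ := key v (by simp)
    have hy : y₁ ≠ y₂ := by
      intro h
      have := hdep _ hm₁ _ hm₂ (by simpa [upd] using h)
      exact huv (by simpa [upd] using this)
    have hx : x₁ ≠ x₂ := by
      intro h
      have := hdep' _ (hT ▸ ht₁) _ (hT ▸ ht₂) (by simpa [upd] using h)
      exact hy (by simpa [upd] using this)
    obtain ⟨z₁, hz₁⟩ := hK _ (hT ▸ ht₁)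
    obtain ⟨z₂, hz₂⟩ := hK _ (hT ▸ ht₂)
    have hk₁ : upd (upd (upd (upd s 0 u) 1 y₁) 0 x₁) 1 z₁ ∈ R₁ ∪ R₂ :=
      hR ▸ ⟨_, hT ▸ ht₁, z₁, hz₁, rfl⟩
    have hk₂ : upd (upd (upd (upd s 0 v) 1 y₂) 0 x₂) 1 z₂ ∈ R₁ ∪ R₂ :=
      hR ▸ ⟨_, hT ▸ ht₂, z₂, hz₂, rfl⟩
    have hz : z₁ = z₂ := hcK _ (hR ▸ hk₁) _ (hR ▸ hk₂)
    have hzD : z₁ ∉ D := hnC _ (hR ▸ hk₁)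
    subst hz
    have e₁ : Vr z₁ x₁ ∨ Hr z₁ x₁ :=
      hk₁.imp (fun h => by simpa [upd] using hR₁ _ h) (fun h => by simpa [upd] using hR₂ _ h)
    have e₂ : Vr z₁ x₂ ∨ Hr z₁ x₂ :=
      hk₂.imp (fun h => by simpa [upd] using hR₁ _ h) (fun h => by simpa [upd] using hR₂ _ h)
    have close : ∀ {x y x' y' : A}, y ∈ D → y' ∈ D → y ≠ y' → Hr x y → Vr x' y' →
        (Vr z₁ x ∨ Hr z₁ x) → (Vr z₁ x' ∨ Hr z₁ x') →
        ∃ a b c b' c' : A, a ∉ D ∧ Vr a b ∧ Hr b c ∧ Hr a b' ∧ Vr b' c' ∧ c ≠ c' := by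
      intro x y x' y' hy hy' hne h1 h2 h3 h4
      have hxD := (hH _ _ h1).2 hy
      have hxD' : x' ∉ D := fun h => (hV _ _ h2).1 h hy'
      exact ⟨z₁, x, y, x', y', hzD, h3.resolve_right fun h => hzD ((hH _ _ h).2 hxD), h1,
        h4.resolve_left fun h => hzD ((hV _ _ h).2 hxD'), h2, hne⟩
    rcases ht₁ with h₁ | h₁ <;> rcases ht₂ with h₂ | h₂
    · exact absurd (by simpa [upd] using hc₁ _ h₁ _ h₂) hx
    · exact close hyD₁ hyD₂ hy (by simpa [upd] using hH₁ _ h₁)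
        (by simpa [upd] using hV₂ _ h₂) e₁ e₂
    · exact close hyD₂ hyD₁ hy.symm (by simpa [upd] using hH₁ _ h₂)
        (by simpa [upd] using hV₂ _ h₁) e₂ e₁
    · exact absurd (by simpa [upd] using hc₂ _ h₁ _ h₂) hx
  · rintro ⟨a, b, c, b', c', ha, hab, hbc, hab', hbc', hne⟩
    classical
    have hb : b ∈ D := by_contra fun h => ha ((hV _ _ hab).2 h)
    have hc : c ∈ D := (hH _ _ hbc).1 hb
    have hb' : b' ∉ D := fun h => ha ((hH _ _ hab').2 h)
    have hc' : c' ∈ D := by_contra fun h => hb' ((hV _ _ hbc').2 h)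
    have hbb : b ≠ b' := fun h => hb' (h ▸ hb)
    set W : Set (ℕ → A) := {s' | ∃ s ∈ X, ∃ a : A, s' = upd s 0 a}
    have hcases : ∀ t ∈ {s' : ℕ → A | ∃ s ∈ {t ∈ W | t 0 ∈ ({u, v} : Set A)},
        ∃ e ∈ ({if s 0 = u then c else c'} : Set A), s' = upd s 1 e},
        t 0 = u ∧ t 1 = c ∨ t 0 = v ∧ t 1 = c' := by
      rintro _ ⟨s, ⟨-, hs | hs⟩, _, rfl, rfl⟩
      · left; simp [upd, hs]
      · right
        rw [Set.mem_singleton_iff] at hs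
        simp [upd, hs, huv.symm]
    set W₁ : Set (ℕ → A) := {s' : ℕ → A | ∃ s ∈ {t ∈ W | t 0 ∈ ({u, v} : Set A)},
        ∃ e ∈ ({if s 0 = u then c else c'} : Set A), s' = upd s 1 e}
    have hcases₂ : ∀ t ∈ {s' : ℕ → A | ∃ s ∈ W₁,
        ∃ e ∈ ({if s 1 = c then b else b'} : Set A), s' = upd s 0 e},
        t 0 = b ∧ t 1 = c ∨ t 0 = b' ∧ t 1 = c' := by
      rintro _ ⟨s, hs, _, rfl, rfl⟩
      rcases hcases s hs with ⟨-, hs⟩ | ⟨-, hs⟩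
      · left; simp [upd, hs]
      · right; simp [upd, hs, hne.symm]
    set W₂ : Set (ℕ → A) := {s' : ℕ → A | ∃ s ∈ W₁,
        ∃ e ∈ ({if s 1 = c then b else b'} : Set A), s' = upd s 0 e}
    have hcases₃ : ∀ t ∈ {s' : ℕ → A | ∃ s ∈ W₂, ∃ e ∈ ({a} : Set A), s' = upd s 1 e},
        (t 0 = b ∨ t 0 = b') ∧ t 1 = a := by
      rintro _ ⟨s, hs, _, rfl, rfl⟩
      rcases hcases₂ s hs with ⟨hs, -⟩ | ⟨hs, -⟩ <;> simp [upd, hs]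
    set W₃ : Set (ℕ → A) := {s' : ℕ → A | ∃ s ∈ W₂, ∃ e ∈ ({a} : Set A), s' = upd s 1 e}
    refine ⟨{t ∈ W | t 0 ∉ ({u, v} : Set A)}, {t ∈ W | t 0 ∈ ({u, v} : Set A)},
      ?_, fun s hs => hs.2, fun s => {if s 0 = u then c else c'},
      fun _ _ => Set.singleton_nonempty _, (hpos _ _).2 ?_, (tsat_dDep _ _ _ _).2 ?_,
      fun s => {if s 1 = c then b else b'},
      fun _ _ => Set.singleton_nonempty _, (tsat_dDep _ _ _ _).2 ?_,
      ⟨{t ∈ W₂ | t 0 = b ∧ t 1 = c}, {t ∈ W₂ | t 0 = b' ∧ t 1 = c'}, ?_,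
        ⟨(tsat_dConst _ _ _).2 ?_, ?_⟩, (tsat_dConst _ _ _).2 ?_, ?_⟩,
      fun _ => {a}, fun _ _ => Set.singleton_nonempty _, (tsat_dConst _ _ _).2 ?_,
      ⟨{t ∈ W₃ | t 0 = b ∧ t 1 = a}, {t ∈ W₃ | t 0 = b' ∧ t 1 = a}, ?_, ?_, ?_⟩, (hneg _ _).2 ?_⟩
    · ext t
      by_cases h : t 0 ∈ ({u, v} : Set A)
      · exact ⟨fun ht => Or.inr ⟨ht, h⟩, fun ht => ht.elim And.left And.left⟩
      · exact ⟨fun ht => Or.inl ⟨ht, h⟩, fun ht => ht.elim And.left And.left⟩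
    · intro s hs
      rcases hcases s hs with ⟨-, h⟩ | ⟨-, h⟩ <;> rw [h] <;> assumption
    · intro s hs s' hs' h
      have h1 := hcases s hs
      have h2 := hcases s' hs'
      grind
    · intro s hs s' hs' h
      have h1 := hcases₂ s hs
      have h2 := hcases₂ s' hs'
      grind
    · ext t
      exact ⟨fun ht => (hcases₂ t ht).imp (⟨ht, ·⟩) (⟨ht, ·⟩), fun ht => ht.elim And.left And.left⟩
    · exact fun s hs s' hs' => hs.2.1.trans hs'.2.1.symm
    · intro s hs
      change Hr (s 0) (s 1)
      rwa [hs.2.1, hs.2.2]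
    · exact fun s hs s' hs' => hs.2.1.trans hs'.2.1.symm
    · intro s hs
      change Vr (s 0) (s 1)
      rwa [hs.2.1, hs.2.2]
    · exact fun s hs s' hs' => (hcases₃ s hs).2.trans (hcases₃ s' hs').2.symm
    · ext t
      exact ⟨fun ht => (hcases₃ t ht).1.imp (⟨ht, ·, (hcases₃ t ht).2⟩)
        (⟨ht, ·, (hcases₃ t ht).2⟩), fun ht => ht.elim And.left And.left⟩
    · intro s hs
      change Vr (s 1) (s 0)
      rwa [hs.2.1, hs.2.2]
    · intro s hs
      change Hr (s 1) (s 0)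
      rwa [hs.2.1, hs.2.2]
    · intro s hs
      rwa [(hcases₃ s hs).2]

/-- Lemma 17 of the paper: let `𝔄` be a
`{V,H,C,U,P,Q}`-structure in which the extension of `U` has exactly two
elements and in which `H(a,b)` implies `(C(a) ⇔ C(b))` and `V(a,b)` implies
`(C(a) ⇔ ¬C(b))`.  Then `𝔄 ⊨ φ_non-join` (team semantics) iff condition (3)
of gridlikeness fails in `𝔄`, i.e. there are `a, b, c, b', c'` with `V(a,b)`,
`H(b,c)`, `H(a,b')`, `V(b',c')` and `c ≠ c'`. -/
theorem nonjoin_characterization (A : Type) (hA : Nonempty A)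
    (Vr Hr : A → A → Prop) (Cs Us Ps Qs : Set A)
    (hU : ∃ u v : A, u ≠ v ∧ Us = {u, v})
    (hHC : ∀ a b : A, Hr a b → (a ∈ Cs ↔ b ∈ Cs))
    (hVC : ∀ a b : A, Vr a b → (a ∈ Cs ↔ b ∉ Cs)) :
    TTrue (mkGrid A Vr Hr Cs Us Ps Qs) phiNonJoin ↔
      ∃ a b c b' c' : A, Vr a b ∧ Hr b c ∧ Hr a b' ∧ Vr b' c' ∧ c ≠ c' := by
  have plus : ∀ {X : Set (ℕ → A)}, X.Nonempty →
      (TSat (mkGrid A Vr Hr Cs Us Ps Qs) phiNonCPlusJoin X ↔ _) := fun hX =>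
    tsat_nonCjoinF hU Cs hHC hVC lC lnC (fun _ _ => Iff.rfl) (fun _ _ => Iff.rfl) hX
  have minus : ∀ {X : Set (ℕ → A)}, X.Nonempty →
      (TSat (mkGrid A Vr Hr Cs Us Ps Qs) phiNonCMinusJoin X ↔ _) := fun hX =>
    tsat_nonCjoinF hU Csᶜ (fun a b h => not_congr (hHC a b h))
      (fun a b h => not_congr (hVC a b h)) lnC lC (fun _ _ => Iff.rfl)
      (fun _ _ => forall₂_congr fun _ _ => not_not.symm) hX
  have huniv : (Set.univ : Set (ℕ → A)).Nonempty := Set.univ_nonempty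
  constructor
  · rintro ⟨Y, Z, hYZ, hY, hZ⟩
    rcases Set.union_nonempty.1 (hYZ ▸ huniv) with h | h
    · obtain ⟨a, b, c, b', c', -, habc⟩ := (plus h).1 hY
      exact ⟨a, b, c, b', c', habc⟩
    · obtain ⟨a, b, c, b', c', -, habc⟩ := (minus h).1 hZ
      exact ⟨a, b, c, b', c', habc⟩
  · rintro ⟨a, b, c, b', c', habc⟩
    by_cases ha : a ∈ Cs
    · exact ⟨∅, Set.univ, (Set.empty_union _).symm, tsat_empty _ _,
        (minus huniv).2 ⟨a, b, c, b', c', not_not.2 ha, habc⟩⟩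
    · exact ⟨Set.univ, ∅, (Set.union_empty _).symm,
        (plus huniv).2 ⟨a, b, c, b', c', ha, habc⟩, tsat_empty _ _⟩
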